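/- Let κ > 0 and λ ∈ ℝ. Let u : [0,1] → ℂ be absolutely continuous with u(0)=u(1)=0 and u' absolutely continuous with u' ∈ L²(0,1); let θ : [0,1] → ℂ be absolutely continuous with θ(0)=θ(1)=0, √a·θ' ∈ L²(0,1), and aθ' absolutely continuous on [0,1] with (aθ')' ∈ L²(0,1); let F, G ∈ L²(0,1;ℂ) satisfy u'' − κθ' + λ²u = F and (aθ')' − iκλu' − iλθ = G a.e. on (0,1). Then ∫₀¹ a(x)|θ'(x)|² dx = Re( iλ ∫₀¹ F(x) conj(u(x)) dx − ∫₀¹ G(x) conj(θ(x)) dx ). -/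

import Mathlib

open MeasureTheory Set intervalIntegral Filter Topology

local notation "conj'" => (starRingEnd ℂ)

/-- A real absolutely continuous function is absolutely continuous as a complex function. -/
theorem AbsolutelyContinuousOnInterval.complex_ofReal {f : ℝ → ℝ} {a b : ℝ}
    (hf : AbsolutelyContinuousOnInterval f a b) :
    AbsolutelyContinuousOnInterval (fun x => (f x : ℂ)) a b := by
  simpa only [AbsolutelyContinuousOnInterval, Complex.isometry_ofReal.dist_eq] using hf

/-- A primitive agrees on the interval with an absolutely continuous function having the expected
derivative almost everywhere. -/
theorem exists_absolutelyContinuous_of_eq_add_integral {f f' : ℝ → ℂ} {a b : ℝ}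
    (hf' : IntervalIntegrable f' volume a b)
    (hf : ∀ x ∈ uIcc a b, f x = f a + ∫ s in a..x, f' s) :
    ∃ P : ℝ → ℂ, AbsolutelyContinuousOnInterval P a b ∧ EqOn f P (uIcc a b) ∧
      ∀ᵐ x, x ∈ uIcc a b → HasDerivAt P (f' x) x := by
  have hre : IntervalIntegrable (fun x => (f' x).re) volume a b := ⟨hf'.1.re, hf'.2.re⟩
  have him : IntervalIntegrable (fun x => (f' x).im) volume a b := ⟨hf'.1.im, hf'.2.im⟩
  refine ⟨fun x => f a + (((∫ s in a..x, (f' s).re : ℝ) : ℂ)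
    + Complex.I • ((∫ s in a..x, (f' s).im : ℝ) : ℂ)), ?_, fun x hx => ?_, ?_⟩
  · have hc : AbsolutelyContinuousOnInterval (fun _ : ℝ => f a) a b :=
      contDiffOn_const.absolutelyContinuousOnInterval
    exact hc.fun_add ((hre.absolutelyContinuousOnInterval_intervalIntegral
      left_mem_uIcc).complex_ofReal.fun_add
      ((him.absolutelyContinuousOnInterval_intervalIntegral
        left_mem_uIcc).complex_ofReal.const_smul Complex.I))
  · have hsub : uIcc a x ⊆ uIcc a b := uIcc_subset_uIcc_left hx
    have hre' : IntervalIntegrable (fun x => ((f' x).re : ℂ)) volume a x :=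
      ⟨(hre.mono_set hsub).1.ofReal, (hre.mono_set hsub).2.ofReal⟩
    have him' : IntervalIntegrable (fun x => ((f' x).im : ℂ)) volume a x :=
      ⟨(him.mono_set hsub).1.ofReal, (him.mono_set hsub).2.ofReal⟩
    simp only [hf x hx, smul_eq_mul]
    rw [← intervalIntegral.integral_ofReal, ← intervalIntegral.integral_ofReal,
      ← intervalIntegral.integral_const_mul,
      ← intervalIntegral.integral_add hre' (him'.const_mul _)]
    simp only [mul_comm Complex.I, Complex.re_add_im]
  · filter_upwards [hre.ae_hasDerivAt_integral, him.ae_hasDerivAt_integral] with x h₁ h₂ hx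
    have h := ((h₁ hx a left_mem_uIcc).ofReal_comp.add
      ((h₂ hx a left_mem_uIcc).ofReal_comp.const_smul Complex.I)).const_add (f a)
    rwa [smul_eq_mul, mul_comm Complex.I, Complex.re_add_im] at h

/-- Fundamental theorem of calculus for an absolutely continuous function with a prescribed
almost everywhere derivative. -/
theorem AbsolutelyContinuousOnInterval.integral_eq_sub_of_ae_hasDerivAt {f f' : ℝ → ℂ} {a b : ℝ}
    (hf : AbsolutelyContinuousOnInterval f a b) (hf' : IntervalIntegrable f' volume a b)
    (hd : ∀ᵐ x, x ∈ uIcc a b → HasDerivAt f (f' x) x) :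
    ∫ x in a..b, f' x = f b - f a := by
  obtain ⟨P, hP, hfP, hPd⟩ := exists_absolutelyContinuous_of_eq_add_integral
    (f := fun x => ∫ s in a..x, f' s) hf' (by simp)
  obtain ⟨C, hC⟩ := (hf.fun_sub hP).const_of_ae_hasDerivAt_zero (by
    filter_upwards [hd, hPd] with x h₁ h₂ hx
    have h := (h₁ hx).sub (h₂ hx)
    rwa [sub_self] at h)
  have hCa := hC a left_mem_uIcc
  have hCb := hC b right_mem_uIcc
  have hPa := hfP left_mem_uIcc
  have hPb := hfP right_mem_uIcc
  simp only [integral_same] at hPa hPb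
  linear_combination hPb - hPa + hCa - hCb

/-- A primitive of an interval integrable function is continuous. -/
theorem continuousOn_of_eq_add_integral {f f' : ℝ → ℂ} {a b : ℝ}
    (hf' : IntervalIntegrable f' volume a b)
    (hf : ∀ x ∈ uIcc a b, f x = f a + ∫ s in a..x, f' s) : ContinuousOn f (uIcc a b) := by
  obtain ⟨P, hP, hfP, -⟩ := exists_absolutelyContinuous_of_eq_add_integral hf' hf
  exact hP.continuousOn.congr hfP

/-- Fundamental theorem of calculus for the product of two primitives. -/
theorem integral_deriv_mul_eq_sub_of_eq_add_integral {f f' g g' : ℝ → ℂ} {a b : ℝ}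
    (hf' : IntervalIntegrable f' volume a b) (hg' : IntervalIntegrable g' volume a b)
    (hf : ∀ x ∈ uIcc a b, f x = f a + ∫ s in a..x, f' s)
    (hg : ∀ x ∈ uIcc a b, g x = g a + ∫ s in a..x, g' s) :
    ∫ x in a..b, (f' x * g x + f x * g' x) = f b * g b - f a * g a := by
  obtain ⟨P, hP, hfP, hPd⟩ := exists_absolutelyContinuous_of_eq_add_integral hf' hf
  obtain ⟨Q, hQ, hgQ, hQd⟩ := exists_absolutelyContinuous_of_eq_add_integral hg' hg
  have hPQ : AbsolutelyContinuousOnInterval (fun x => P x * Q x) a b := hP.fun_smul hQ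
  rw [intervalIntegral.integral_congr (g := fun x => f' x * Q x + P x * g' x)
    (fun x hx => by simp only [hfP hx, hgQ hx]), hfP left_mem_uIcc, hfP right_mem_uIcc,
    hgQ left_mem_uIcc, hgQ right_mem_uIcc]
  refine hPQ.integral_eq_sub_of_ae_hasDerivAt
    ((hf'.mul_continuousOn hQ.continuousOn).add (hg'.continuousOn_mul hP.continuousOn)) ?_
  filter_upwards [hPd, hQd] with x h₁ h₂ hx
  exact (h₁ hx).mul (h₂ hx)

/-- Complex conjugation preserves interval integrability. -/
theorem IntervalIntegrable.conj {f : ℝ → ℂ} {a b : ℝ}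
    (hf : IntervalIntegrable f volume a b) :
    IntervalIntegrable (fun x => conj' (f x)) volume a b :=
  ⟨Complex.conjCLE.toContinuousLinearMap.integrable_comp hf.1,
    Complex.conjCLE.toContinuousLinearMap.integrable_comp hf.2⟩

/-- Complex conjugation commutes with the interval integral. -/
theorem intervalIntegral_conj_eq (f : ℝ → ℂ) (a b : ℝ) :
    ∫ x in a..b, conj' (f x) = conj' (∫ x in a..b, f x) := by
  simp only [intervalIntegral, integral_conj, map_sub]

/-- Integration by parts against the conjugate of a primitive vanishing at both endpoints. -/
theorem integral_deriv_mul_conj_eq_neg {f f' g g' : ℝ → ℂ} {a b : ℝ}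
    (hf' : IntervalIntegrable f' volume a b) (hg' : IntervalIntegrable g' volume a b)
    (hf : ∀ x ∈ uIcc a b, f x = f a + ∫ s in a..x, f' s)
    (hg : ∀ x ∈ uIcc a b, g x = g a + ∫ s in a..x, g' s) (hga : g a = 0) (hgb : g b = 0) :
    ∫ x in a..b, f' x * conj' (g x) = -∫ x in a..b, f x * conj' (g' x) := by
  have hgc : ∀ x ∈ uIcc a b, conj' (g x) = conj' (g a) + ∫ s in a..x, conj' (g' s) := by
    intro x hx
    rw [hg x hx, map_add, intervalIntegral_conj_eq]
  have h := integral_deriv_mul_eq_sub_of_eq_add_integral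
    (g := fun x => conj' (g x)) hf' hg'.conj hf hgc
  rw [integral_add
    (hf'.mul_continuousOn (continuousOn_of_eq_add_integral (f := fun x => conj' (g x)) hg'.conj hgc))
    (hg'.conj.continuousOn_mul (continuousOn_of_eq_add_integral hf' hf)), hga, hgb] at h
  simp only [map_zero, mul_zero, sub_zero] at h
  exact eq_neg_of_add_eq_zero_left h

/-- The integral of `f * conj f` is real. -/
theorem im_integral_mul_conj_self (f : ℝ → ℂ) (a b : ℝ) :
    (∫ x in a..b, f x * conj' (f x)).im = 0 := by
  simp only [Complex.mul_conj, intervalIntegral.integral_ofReal, Complex.ofReal_im]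

/-- (Weakly degenerate case.) For solutions of the resolvent system
`u'' − κθ' + λ²u = F`, `(aθ')' − iκλu' − iλθ = G`, one has
`∫₀¹ a|θ'|² = Re( iλ ∫₀¹ F conj u − ∫₀¹ G conj θ )`. -/
theorem stmt_13 (a : ℝ → ℝ)
    (haC : ContinuousOn a (Icc (0:ℝ) 1))
    (haC1 : ContDiffOn ℝ 1 a (Ioc (0:ℝ) 1))
    (ha0 : a 0 = 0)
    (hapos : ∀ x ∈ Ioc (0:ℝ) 1, 0 < a x)
    (haL1 : IntegrableOn (fun x => (a x)⁻¹) (Ioc (0:ℝ) 1) volume)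
    (κ : ℝ) (hκ : 0 < κ) (lam : ℝ)
    (u u' u'' θ θ' b b' F G : ℝ → ℂ)
    -- u absolutely continuous, u(0)=u(1)=0, u' absolutely continuous with u' ∈ L²
    (hu'int : IntervalIntegrable u' volume 0 1)
    (huAC : ∀ x ∈ Icc (0:ℝ) 1, u x = u 0 + ∫ s in (0:ℝ)..x, u' s)
    (hu0 : u 0 = 0) (hu1 : u 1 = 0)
    (hu'L2 : MemLp u' 2 (volume.restrict (Ioc (0:ℝ) 1)))
    (hu''int : IntervalIntegrable u'' volume 0 1)
    (hu'AC : ∀ x ∈ Icc (0:ℝ) 1, u' x = u' 0 + ∫ s in (0:ℝ)..x, u'' s)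
    -- θ absolutely continuous, θ(0)=θ(1)=0, √a·θ' ∈ L²
    (hθ'int : IntervalIntegrable θ' volume 0 1)
    (hθAC : ∀ x ∈ Icc (0:ℝ) 1, θ x = θ 0 + ∫ s in (0:ℝ)..x, θ' s)
    (hθ0 : θ 0 = 0) (hθ1 : θ 1 = 0)
    (hθ'L2 : MemLp (fun x => (Real.sqrt (a x) : ℂ) * θ' x) 2 (volume.restrict (Ioc (0:ℝ) 1)))
    -- aθ' absolutely continuous with (aθ')' ∈ L²
    (hb : ∀ x ∈ Ioc (0:ℝ) 1, b x = (a x : ℂ) * θ' x)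
    (hb'int : IntervalIntegrable b' volume 0 1)
    (hbAC : ∀ x ∈ Icc (0:ℝ) 1, b x = b 0 + ∫ s in (0:ℝ)..x, b' s)
    (hb'L2 : MemLp b' 2 (volume.restrict (Ioc (0:ℝ) 1)))
    -- F, G ∈ L² and the resolvent equations hold a.e.
    (hFL2 : MemLp F 2 (volume.restrict (Ioc (0:ℝ) 1)))
    (hGL2 : MemLp G 2 (volume.restrict (Ioc (0:ℝ) 1)))
    (heq1 : ∀ᵐ x ∂volume, x ∈ Ioo (0:ℝ) 1 →
      u'' x - (κ : ℂ) * θ' x + (lam : ℂ) ^ 2 * u x = F x)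
    (heq2 : ∀ᵐ x ∂volume, x ∈ Ioo (0:ℝ) 1 →
      b' x - Complex.I * κ * lam * u' x - Complex.I * lam * θ x = G x) :
    ∫ x in (0:ℝ)..1, a x * ‖θ' x‖ ^ 2
      = (Complex.I * lam * (∫ x in (0:ℝ)..1, F x * conj' (u x))
          - ∫ x in (0:ℝ)..1, G x * conj' (θ x)).re := by
  have hI : uIcc (0:ℝ) 1 = Icc 0 1 := uIcc_of_le zero_le_one
  rw [← hI] at huAC hu'AC hθAC hbAC
  have huC := continuousOn_of_eq_add_integral hu'int huAC
  have hθC := continuousOn_of_eq_add_integral hθ'int hθAC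
  have huC' : ContinuousOn (fun x => conj' (u x)) (uIcc 0 1) :=
    Complex.continuous_conj.comp_continuousOn huC
  have hθC' : ContinuousOn (fun x => conj' (θ x)) (uIcc 0 1) :=
    Complex.continuous_conj.comp_continuousOn hθC
  have hF : ∫ x in (0:ℝ)..1, F x * conj' (u x) =
      (∫ x in (0:ℝ)..1, u'' x * conj' (u x)) - κ * (∫ x in (0:ℝ)..1, θ' x * conj' (u x))
        + (lam : ℂ) ^ 2 * ∫ x in (0:ℝ)..1, u x * conj' (u x) := by
    rw [← intervalIntegral.integral_const_mul, ← intervalIntegral.integral_const_mul,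
      ← intervalIntegral.integral_sub (hu''int.mul_continuousOn huC')
        ((hθ'int.mul_continuousOn huC').const_mul _),
      ← intervalIntegral.integral_add ((hu''int.mul_continuousOn huC').sub
        ((hθ'int.mul_continuousOn huC').const_mul _))
        ((huC.fun_mul huC').intervalIntegrable.const_mul _)]
    refine intervalIntegral.integral_congr_ae ?_
    filter_upwards [heq1, Measure.ae_ne volume (1:ℝ)] with x hx hx1 hxI
    rw [uIoc_of_le zero_le_one] at hxI
    rw [← hx ⟨hxI.1, lt_of_le_of_ne hxI.2 hx1⟩]
    ring
  have hG : ∫ x in (0:ℝ)..1, G x * conj' (θ x) =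
      (∫ x in (0:ℝ)..1, b' x * conj' (θ x))
        - Complex.I * κ * lam * (∫ x in (0:ℝ)..1, u' x * conj' (θ x))
        - Complex.I * lam * ∫ x in (0:ℝ)..1, θ x * conj' (θ x) := by
    rw [← intervalIntegral.integral_const_mul, ← intervalIntegral.integral_const_mul,
      ← intervalIntegral.integral_sub (hb'int.mul_continuousOn hθC')
        ((hu'int.mul_continuousOn hθC').const_mul _),
      ← intervalIntegral.integral_sub ((hb'int.mul_continuousOn hθC').sub
        ((hu'int.mul_continuousOn hθC').const_mul _))
        ((hθC.fun_mul hθC').intervalIntegrable.const_mul _)]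
    refine intervalIntegral.integral_congr_ae ?_
    filter_upwards [heq2, Measure.ae_ne volume (1:ℝ)] with x hx hx1 hxI
    rw [uIoc_of_le zero_le_one] at hxI
    rw [← hx ⟨hxI.1, lt_of_le_of_ne hxI.2 hx1⟩]
    ring
  have hdiss : ∫ x in (0:ℝ)..1, b x * conj' (θ' x) =
      ((∫ x in (0:ℝ)..1, a x * ‖θ' x‖ ^ 2 : ℝ) : ℂ) := by
    rw [← intervalIntegral.integral_ofReal]
    refine intervalIntegral.integral_congr_ae (.of_forall fun x hx => ?_)
    rw [uIoc_of_le zero_le_one] at hx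
    rw [hb x hx, mul_assoc, Complex.mul_conj, Complex.normSq_eq_norm_sq, Complex.ofReal_mul]
  have hcross : ∫ x in (0:ℝ)..1, θ x * conj' (u' x) =
      conj' (∫ x in (0:ℝ)..1, u' x * conj' (θ x)) := by
    rw [← intervalIntegral_conj_eq]
    simp only [map_mul, Complex.conj_conj, mul_comm]
  rw [integral_deriv_mul_conj_eq_neg hu''int hu'int hu'AC huAC hu0 hu1,
    integral_deriv_mul_conj_eq_neg hθ'int hu'int hθAC huAC hu0 hu1, hcross] at hF
  rw [integral_deriv_mul_conj_eq_neg hb'int hθ'int hbAC hθAC hθ0 hθ1, hdiss] at hG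
  rw [hF, hG]
  simp only [pow_two (lam : ℂ), Complex.add_re, Complex.sub_re, Complex.mul_re, Complex.neg_re,
    Complex.add_im, Complex.sub_im, Complex.mul_im, Complex.neg_im, Complex.I_re, Complex.I_im,
    Complex.ofReal_re, Complex.ofReal_im, Complex.conj_re, Complex.conj_im,
    im_integral_mul_conj_self]
  ring
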